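/- arXiv:2305.15202 — 6 statements merged into one kernel-verified Lean document; each statement's English description precedes it below -/
import Mathlib

section
/- Let G be a strongly connected directed graph on n nodes (n ≥ 1) with out-degrees d_j^+. Define the matrix P ∈ ℝ^{n×n} by P_{ij} = 1/(1+d_j^+) if (i,j) is an edge of G or i = j, and P_{ij} = 0 otherwise. Let x, y : ℕ → ℝ^n evolve as x(k+1) = P x(k) and y(k+1) = P y(k), where x(0) is arbitrary and y_i(0) = 1 for every i. Then for every node i, the ratio x_i(k)/y_i(k) converges as k → ∞ to (1/n) ∑_{j=1}^n x_j(0). -/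
open Matrix in
/-- A column-stochastic matrix whose entries are all at least `a` contracts the `ℓ¹` norm of
vectors of zero sum by the factor `1 - card ι * a`. -/
theorem sum_abs_mulVec_le_of_sum_eq_zero {ι : Type*} [Fintype ι] [DecidableEq ι]
    {M : Matrix ι ι ℝ} (hM : M ∈ colStochastic ℝ ι) {a : ℝ} (ha : ∀ i j, a ≤ M i j)
    {w : ι → ℝ} (hw : ∑ j, w j = 0) :
    ∑ i, |(M *ᵥ w) i| ≤ (1 - Fintype.card ι * a) * ∑ j, |w j| := by
  have hshift (i : ι) : (M *ᵥ w) i = ∑ j, (M i j - a) * w j := by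
    simp [mulVec, dotProduct, sub_mul, Finset.sum_sub_distrib, ← Finset.mul_sum, hw]
  calc ∑ i, |(M *ᵥ w) i|
      ≤ ∑ i, ∑ j, (M i j - a) * |w j| := by
        refine Finset.sum_le_sum fun i _ => ?_
        rw [hshift]
        refine (Finset.abs_sum_le_sum_abs _ _).trans_eq (Finset.sum_congr rfl fun j _ => ?_)
        rw [abs_mul, abs_of_nonneg (sub_nonneg.2 (ha i j))]
    _ = (1 - Fintype.card ι * a) * ∑ j, |w j| := by
        rw [Finset.sum_comm, Finset.mul_sum]
        refine Finset.sum_congr rfl fun j _ => ?_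
        rw [← Finset.sum_mul, Finset.sum_sub_distrib, sum_col_of_mem_colStochastic hM]
        simp

/-- A column-stochastic matrix does not increase the `ℓ¹` norm. -/
theorem sum_abs_mulVec_le_sum_abs {ι : Type*} [Fintype ι] [DecidableEq ι]
    {M : Matrix ι ι ℝ} (hM : M ∈ Matrix.colStochastic ℝ ι) (w : ι → ℝ) :
    ∑ i, |(M.mulVec w) i| ≤ ∑ j, |w j| := by
  rw [← Matrix.sum_mulVec_of_mem_colStochastic (x := fun j => |w j|) hM]
  refine Finset.sum_le_sum fun i _ => (Finset.abs_sum_le_sum_abs _ _).trans_eq ?_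
  exact Finset.sum_congr rfl fun j _ => by
    rw [abs_mul, abs_of_nonneg (Matrix.nonneg_of_mem_colStochastic hM)]

/-- The iterates of a linear recursion are given by matrix powers. -/
theorem apply_add_eq_pow_mulVec {ι : Type*} [Fintype ι] [DecidableEq ι]
    {P : Matrix ι ι ℝ} {v : ℕ → ι → ℝ} (hv : ∀ k, v (k + 1) = P.mulVec (v k)) (k m : ℕ) :
    v (k + m) = (P ^ m).mulVec (v k) := by
  induction m with
  | zero => simp
  | succ m ih => rw [← add_assoc, hv, ih, Matrix.mulVec_mulVec, pow_succ']

/-- If some power of a column-stochastic matrix is entrywise positive, then its iterates send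
every vector of zero sum to zero. -/
theorem tendsto_zero_of_sum_eq_zero {ι : Type*} [Fintype ι] [DecidableEq ι] [Nonempty ι]
    {P : Matrix ι ι ℝ} (hP : P ∈ Matrix.colStochastic ℝ ι) {m : ℕ} {a : ℝ} (ha : 0 < a)
    (hPa : ∀ i j, a ≤ (P ^ m) i j) {w : ℕ → ι → ℝ} (hw : ∀ k, w (k + 1) = P.mulVec (w k))
    (hw0 : ∑ i, w 0 i = 0) (i : ι) :
    Filter.Tendsto (fun k => w k i) Filter.atTop (nhds 0) := by
  have hsum (k : ℕ) : ∑ i, w k i = 0 := by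
    induction k with
    | zero => exact hw0
    | succ k ih => rw [hw, Matrix.sum_mulVec_of_mem_colStochastic hP, ih]
  have hanti : Antitone fun k => ∑ i, |w k i| :=
    antitone_nat_of_succ_le fun k => by
      rw [hw]
      exact sum_abs_mulVec_le_sum_abs hP (w k)
  have hnonneg (k : ℕ) : 0 ≤ ∑ i, |w k i| := Finset.sum_nonneg fun _ _ => abs_nonneg _
  obtain ⟨L, hL⟩ : ∃ L, Filter.Tendsto (fun k => ∑ i, |w k i|) Filter.atTop (nhds L) :=
    ⟨_, tendsto_atTop_ciInf hanti ⟨0, by rintro _ ⟨k, rfl⟩; exact hnonneg k⟩⟩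
  have hL0 : 0 ≤ L := ge_of_tendsto' hL hnonneg
  have hLle : L ≤ (1 - Fintype.card ι * a) * L :=
    le_of_tendsto_of_tendsto' ((Filter.tendsto_add_atTop_iff_nat m).2 hL) (hL.const_mul _)
      fun k => by
        rw [apply_add_eq_pow_mulVec hw k m]
        exact sum_abs_mulVec_le_of_sum_eq_zero (pow_mem hP m) hPa (hsum k)
  have hcard : 0 < (Fintype.card ι : ℝ) * a :=
    mul_pos (Nat.cast_pos.2 Fintype.card_pos) ha
  obtain rfl : L = 0 := by nlinarith
  exact squeeze_zero_norm
    (fun k => Finset.single_le_sum (f := fun i => |w k i|) (fun _ _ => abs_nonneg _)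
      (Finset.mem_univ i)) hL

/-- A product of nonnegative matrices has a positive entry along any pair of composable positive
entries. -/
theorem mul_apply_pos_of_nonneg {ι : Type*} [Fintype ι] {A B : Matrix ι ι ℝ}
    (hA : ∀ i j, 0 ≤ A i j) (hB : ∀ i j, 0 ≤ B i j) {i j l : ι}
    (hij : 0 < A i j) (hjl : 0 < B j l) : 0 < (A * B) i l :=
  (mul_pos hij hjl).trans_le <|
    Finset.single_le_sum (f := fun j => A i j * B j l) (fun j _ => mul_nonneg (hA i j) (hB j l))
      (Finset.mem_univ j)

/-- A column-stochastic matrix with positive diagonal whose positive entries contain the edges of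
a strongly connected relation has a power with entries bounded below by a positive constant. -/
theorem exists_pow_apply_ge_of_transGen {ι : Type*} [Fintype ι] [DecidableEq ι] [Nonempty ι]
    {P : Matrix ι ι ℝ} (hP : P ∈ Matrix.colStochastic ℝ ι) {E : ι → ι → Prop}
    (hdiag : ∀ i, 0 < P i i) (hE : ∀ i j, E i j → 0 < P i j)
    (hconn : ∀ i j, i ≠ j → Relation.TransGen E i j) :
    ∃ (m : ℕ) (a : ℝ), 0 < a ∧ ∀ i j, a ≤ (P ^ m) i j := by
  have hpow (k : ℕ) (i j : ι) : 0 ≤ (P ^ k) i j :=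
    Matrix.nonneg_of_mem_colStochastic (pow_mem hP k)
  have hnonneg (i j : ι) : 0 ≤ P i j := Matrix.nonneg_of_mem_colStochastic hP
  have hreach (i j : ι) : ∃ k, 0 < (P ^ k) i j := by
    by_cases hij : i = j
    · exact ⟨0, by simp [hij]⟩
    · have hreach := hconn i j hij
      clear hij
      induction hreach with
      | single h => exact ⟨1, by simpa using hE _ _ h⟩
      | tail _ h ih =>
        obtain ⟨k, hk⟩ := ih
        exact ⟨k + 1, pow_succ P k ▸ mul_apply_pos_of_nonneg (hpow k) hnonneg hk (hE _ _ h)⟩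
  choose k hk using hreach
  have hmono {i j : ι} {s t : ℕ} (hst : s ≤ t) (hs : 0 < (P ^ s) i j) : 0 < (P ^ t) i j := by
    induction t, hst using Nat.le_induction with
    | base => exact hs
    | succ t _ ih => exact pow_succ P t ▸ mul_apply_pos_of_nonneg (hpow t) hnonneg ih (hdiag j)
  let m := Finset.univ.sup fun p : ι × ι => k p.1 p.2
  obtain ⟨p, hp⟩ := Finite.exists_min fun p : ι × ι => (P ^ m) p.1 p.2
  refine ⟨m, (P ^ m) p.1 p.2, hmono ?_ (hk p.1 p.2), fun i j => hp (i, j)⟩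
  exact Finset.le_sup (f := fun p : ι × ι => k p.1 p.2) (Finset.mem_univ p)

/-- The push-sum weight matrix of a directed graph is column stochastic. -/
theorem mem_colStochastic_of_pushSum {ι : Type*} [Fintype ι] [DecidableEq ι]
    {E : ι → ι → Prop} [DecidableRel E] {d : ι → ℕ}
    (hd : ∀ j, d j = Nat.card {i : ι // i ≠ j ∧ E i j}) {P : Matrix ι ι ℝ}
    (hP : ∀ i j, P i j = if E i j ∨ i = j then ((1 : ℝ) + d j)⁻¹ else 0) :
    P ∈ Matrix.colStochastic ℝ ι := by
  rw [Matrix.mem_colStochastic_iff_sum]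
  refine ⟨fun i j => ?_, fun j => ?_⟩
  · rw [hP]
    split_ifs <;> positivity
  · have hfilter : (Finset.univ.filter fun i => E i j ∨ i = j) =
        insert j (Finset.univ.filter fun i => i ≠ j ∧ E i j) := by
      ext i
      simp only [Finset.mem_filter, Finset.mem_univ, true_and, Finset.mem_insert]
      tauto
    have hcard : ((Finset.univ.filter fun i => E i j ∨ i = j).card : ℝ) = 1 + d j := by
      rw [hfilter, Finset.card_insert_of_notMem (by simp), hd, Nat.card_eq_fintype_card,
        Fintype.card_subtype]
      push_cast
      ring
    simp_rw [hP]
    rw [← Finset.sum_filter, Finset.sum_const, nsmul_eq_mul, hcard]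
    exact mul_inv_cancel₀ (by positivity)


/-- **Push-sum ratio consensus (Proposition 1).**
Let `G` be a strongly connected directed graph on `n` nodes (`n ≥ 1`) with
out-degrees `d j`.  Define `P i j = 1/(1 + d j)` if `(i,j)` is an edge or `i = j`,
and `0` otherwise.  If `x (k+1) = P x k` and `y (k+1) = P y k` with `y 0 = 1`,
then for every node `i` the ratio `x k i / y k i` converges to the average of the
initial values `x 0`. -/
theorem push_sum_ratio_consensus
    (n : ℕ) (hn : 1 ≤ n)
    (E : Fin n → Fin n → Prop) [DecidableRel E]
    (hconn : ∀ i j : Fin n, i ≠ j → Relation.TransGen E i j)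
    (d : Fin n → ℕ)
    (hd : ∀ j, d j = Nat.card {i : Fin n // i ≠ j ∧ E i j})
    (P : Matrix (Fin n) (Fin n) ℝ)
    (hP : ∀ i j, P i j = if E i j ∨ i = j then ((1 : ℝ) + d j)⁻¹ else 0)
    (x y : ℕ → Fin n → ℝ)
    (hx : ∀ k, x (k + 1) = P.mulVec (x k))
    (hy : ∀ k, y (k + 1) = P.mulVec (y k))
    (hy0 : ∀ i, y 0 i = 1) :
    ∀ i : Fin n,
      Filter.Tendsto (fun k => x k i / y k i) Filter.atTop
        (nhds ((∑ j, x 0 j) / n)) := by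
  intro i
  have : Nonempty (Fin n) := ⟨i⟩
  have hn0 : (n : ℝ) ≠ 0 := by positivity
  have hPc := mem_colStochastic_of_pushSum hd hP
  obtain ⟨m, a, ha, hPa⟩ := exists_pow_apply_ge_of_transGen hPc (E := E)
    (fun j => by rw [hP, if_pos (Or.inr rfl)]; positivity)
    (fun j l h => by rw [hP, if_pos (Or.inl h)]; positivity) hconn
  have hypow (k : ℕ) : y k = (P ^ k).mulVec 1 := by
    simpa [show y 0 = 1 from funext hy0] using apply_add_eq_pow_mulVec hy 0 k
  have hynonneg (k : ℕ) (j : Fin n) : 0 ≤ y k j := by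
    rw [hypow]
    exact Matrix.nonneg_mulVec_of_mem_colStochastic (pow_mem hPc k) (fun _ => zero_le_one) j
  have hysum (k : ℕ) : ∑ j, y k j = n := by
    rw [hypow, Matrix.sum_mulVec_of_mem_colStochastic (pow_mem hPc k)]
    simp
  have hylower (k : ℕ) : a * n ≤ y (k + m) i := by
    rw [apply_add_eq_pow_mulVec hy, ← hysum k, Finset.mul_sum]
    exact Finset.sum_le_sum fun j _ => mul_le_mul_of_nonneg_right (hPa i j) (hynonneg k j)
  have han : 0 < a * n := by positivity
  set c : ℝ := (∑ j, x 0 j) / n with hc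
  have hw := tendsto_zero_of_sum_eq_zero hPc ha hPa (w := fun k => x k - c • y k)
    (fun k => by rw [hx, hy, Matrix.mulVec_sub, Matrix.mulVec_smul])
    (by simp [Finset.sum_sub_distrib, hy0, hc, mul_div_cancel₀ _ hn0]) i
  rw [← Filter.tendsto_add_atTop_iff_nat m, tendsto_iff_norm_sub_tendsto_zero]
  have hbound := ((Filter.tendsto_add_atTop_iff_nat m).2 hw).norm.div_const (a * n)
  rw [norm_zero, zero_div] at hbound
  refine squeeze_zero (fun _ => norm_nonneg _) (fun k => ?_) hbound
  have hypos : 0 < y (k + m) i := han.trans_le (hylower k)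
  have hdiff : x (k + m) i / y (k + m) i - c =
      (x (k + m) - c • y (k + m)) i / y (k + m) i := by
    simp only [Pi.sub_apply, Pi.smul_apply, smul_eq_mul]
    field_simp
  rw [hdiff, norm_div, Real.norm_of_nonneg hypos.le]
  exact div_le_div_of_nonneg_left (norm_nonneg _) han (hylower k)
end

section
/- Let G be a strongly connected directed graph on n nodes with out-degrees d_j^+. Define P ∈ ℝ^{n×n} by P_{ij} = 1/(2+d_j^+) if (i,j) is an edge of G or i = j, and P_{ij} = 0 otherwise; let Λ = diag(1/(2+d_1^+),…,1/(2+d_n^+)); and let P̂ ∈ ℝ^{2n×2n} be the block matrix P̂ = [[P, (1/2)I_n],[Λ, (1/2)I_n]]. Then P̂ is column-stochastic, has strictly positive diagonal entries, and is irreducible; consequently P̂ is primitive. -/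
namespace Matrix

variable {ι R : Type*} [Fintype ι] [DecidableEq ι] [Semiring R] [PartialOrder R]
  [IsStrictOrderedRing R] {A : Matrix ι ι R}

theorem pow_apply_nonneg_of_nonneg (hA : ∀ i j, 0 ≤ A i j) (k : ℕ) (i j : ι) :
    0 ≤ (A ^ k) i j := by
  induction k generalizing j with
  | zero =>
    rw [pow_zero, one_apply]
    split_ifs <;> simp
  | succ k ih =>
    rw [pow_succ, mul_apply]
    exact Finset.sum_nonneg fun l _ => mul_nonneg (ih l) (hA l j)

theorem pow_succ_apply_pos (hA : ∀ i j, 0 ≤ A i j) {k : ℕ} {i j l : ι}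
    (hij : 0 < (A ^ k) i j) (hjl : 0 < A j l) : 0 < (A ^ (k + 1)) i l := by
  rw [pow_succ, mul_apply]
  exact Finset.sum_pos' (fun m _ => mul_nonneg (pow_apply_nonneg_of_nonneg hA k i m) (hA m l))
    ⟨j, Finset.mem_univ j, mul_pos hij hjl⟩

theorem exists_pow_apply_pos_of_reflTransGen (hA : ∀ i j, 0 ≤ A i j) {i j : ι}
    (h : Relation.ReflTransGen (fun i j => 0 < A i j) i j) : ∃ k : ℕ, 0 < (A ^ k) i j := by
  induction h with
  | refl => exact ⟨0, by simp⟩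
  | tail _ hbc ih =>
    obtain ⟨k, hk⟩ := ih
    exact ⟨k + 1, pow_succ_apply_pos hA hk hbc⟩

theorem pow_apply_pos_mono (hA : ∀ i j, 0 ≤ A i j) (hdiag : ∀ i, 0 < A i i) {k m : ℕ}
    (hkm : k ≤ m) {i j : ι} (h : 0 < (A ^ k) i j) : 0 < (A ^ m) i j := by
  induction hkm with
  | refl => exact h
  | step _ ih => exact pow_succ_apply_pos hA ih (hdiag j)

/-- A nonnegative matrix with positive diagonal whose positivity digraph is strongly connected
has an entrywise positive power. -/
theorem exists_pow_pos_of_diag_pos (hA : ∀ i j, 0 ≤ A i j) (hdiag : ∀ i, 0 < A i i)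
    (hconn : ∀ i j, Relation.ReflTransGen (fun i j => 0 < A i j) i j) :
    ∃ k : ℕ, 1 ≤ k ∧ ∀ i j, 0 < (A ^ k) i j := by
  choose K hK using fun i j => exists_pow_apply_pos_of_reflTransGen hA (hconn i j)
  refine ⟨(Finset.univ.sup fun p : ι × ι => K p.1 p.2) + 1, by simp, fun i j => ?_⟩
  have hle : K i j ≤ Finset.univ.sup fun p : ι × ι => K p.1 p.2 :=
    Finset.le_sup (f := fun p : ι × ι => K p.1 p.2) (Finset.mem_univ (i, j))
  exact pow_apply_pos_mono hA hdiag (hle.trans (Nat.le_succ _)) (hK i j)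

end Matrix

/-- The closed out-neighbourhood of a vertex has one more element than the open one. -/
theorem card_filter_rel_or_eq {α : Type*} [Fintype α] [DecidableEq α] (E : α → α → Prop)
    [DecidableRel E] (j : α) :
    (Finset.univ.filter fun i => E i j ∨ i = j).card =
      Nat.card {i : α // i ≠ j ∧ E i j} + 1 := by
  rw [Nat.card_eq_fintype_card, Fintype.card_subtype]
  have h : (Finset.univ.filter fun i => E i j ∨ i = j) =
      insert j (Finset.univ.filter fun i => i ≠ j ∧ E i j) := by
    ext i
    simp only [Finset.mem_filter_univ, Finset.mem_insert]
    tauto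
  rw [h, Finset.card_insert_of_notMem (by simp)]

/-- **Properties of the state-decomposition push-sum matrix `P̂` (iteration (2)).**
For a strongly connected digraph with out-degrees `d j`, let
`P i j = 1/(2 + d j)` if `(i,j)` is an edge or `i = j` (and `0` otherwise),
`Λ = diag (1/(2 + d j))`, and `P̂ = [[P, (1/2)I],[Λ, (1/2)I]]`.
Then `P̂` is column-stochastic, has strictly positive diagonal entries, is
irreducible, and consequently is primitive. -/
theorem state_decomposition_matrix_primitive
    (n : ℕ)
    (E : Fin n → Fin n → Prop) [DecidableRel E]
    (hconn : ∀ i j : Fin n, i ≠ j → Relation.TransGen E i j)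
    (d : Fin n → ℕ)
    (hd : ∀ j, d j = Nat.card {i : Fin n // i ≠ j ∧ E i j})
    (P : Matrix (Fin n) (Fin n) ℝ)
    (hP : ∀ i j, P i j = if E i j ∨ i = j then ((2 : ℝ) + d j)⁻¹ else 0)
    (Λ : Matrix (Fin n) (Fin n) ℝ)
    (hΛ : Λ = Matrix.diagonal fun j => ((2 : ℝ) + d j)⁻¹)
    (Phat : Matrix (Fin n ⊕ Fin n) (Fin n ⊕ Fin n) ℝ)
    (hPhat : Phat = Matrix.fromBlocks P ((2 : ℝ)⁻¹ • (1 : Matrix (Fin n) (Fin n) ℝ))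
        Λ ((2 : ℝ)⁻¹ • (1 : Matrix (Fin n) (Fin n) ℝ))) :
    (∀ i j, 0 ≤ Phat i j) ∧ (∀ j, ∑ i, Phat i j = 1) ∧
    (∀ i, 0 < Phat i i) ∧
    (∀ i j, ∃ k : ℕ, 1 ≤ k ∧ 0 < (Phat ^ k) i j) ∧
    (∃ k : ℕ, 1 ≤ k ∧ ∀ i j, 0 < (Phat ^ k) i j) := by
  have hpos : ∀ j, (0 : ℝ) < ((2 : ℝ) + d j)⁻¹ := fun j => by positivity
  have hnonneg : ∀ i j, 0 ≤ Phat i j := by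
    subst hPhat hΛ
    rintro (i | i) (j | j)
    · simp only [Matrix.fromBlocks_apply₁₁, hP]
      split_ifs
      exacts [(hpos j).le, le_rfl]
    · simp only [Matrix.fromBlocks_apply₁₂, Matrix.smul_apply, Matrix.one_apply]
      split_ifs <;> simp
    · simp only [Matrix.fromBlocks_apply₂₁, Matrix.diagonal_apply]
      split_ifs
      exacts [(hpos i).le, le_rfl]
    · simp only [Matrix.fromBlocks_apply₂₂, Matrix.smul_apply, Matrix.one_apply]
      split_ifs <;> simp
  have hsum : ∀ j, ∑ i, Phat i j = 1 := by
    subst hPhat hΛ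
    rintro (j | j)
    · have hcard := card_filter_rel_or_eq E j
      rw [← hd j] at hcard
      simp only [Fintype.sum_sum_type, Matrix.fromBlocks_apply₁₁, Matrix.fromBlocks_apply₂₁, hP,
        Matrix.diagonal_apply, Finset.sum_ite_eq', Finset.mem_univ, if_true]
      rw [← Finset.sum_filter, Finset.sum_const, hcard, nsmul_eq_mul]
      have h2 : (2 : ℝ) + d j ≠ 0 := by positivity
      push_cast
      field_simp
      ring
    · simp only [Fintype.sum_sum_type, Matrix.fromBlocks_apply₁₂, Matrix.fromBlocks_apply₂₂,
        Matrix.smul_apply, Matrix.one_apply, smul_eq_mul, mul_ite, mul_one, mul_zero,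
        Finset.sum_ite_eq', Finset.mem_univ, if_true]
      norm_num
  have hdiag : ∀ i, 0 < Phat i i := by
    subst hPhat
    rintro (i | i)
    · simpa [hP] using hpos i
    · simp
  have hlr : ∀ i, 0 < Phat (Sum.inl i) (Sum.inr i) := by
    subst hPhat
    simp
  have hrl : ∀ i, 0 < Phat (Sum.inr i) (Sum.inl i) := by
    subst hPhat hΛ
    simpa using hpos
  have hll : ∀ i j, Relation.ReflTransGen (fun a b => 0 < Phat a b) (Sum.inl i) (Sum.inl j) := by
    intro i j
    by_cases hij : i = j
    · rw [hij]
    · refine (hconn i j hij).to_reflTransGen.lift Sum.inl fun a b hab => ?_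
      subst hPhat
      simpa [Function.onFun, hP, hab] using hpos b
  have hreach : ∀ i j, Relation.ReflTransGen (fun a b => 0 < Phat a b) i j := by
    rintro (i | i) (j | j)
    · exact hll i j
    · exact (hll i j).tail (hlr j)
    · exact .trans (.single (hrl i)) (hll i j)
    · exact .trans (.single (hrl i)) ((hll i j).tail (hlr j))
  obtain ⟨k, hk, hprim⟩ := Matrix.exists_pow_pos_of_diag_pos hnonneg hdiag hreach
  exact ⟨hnonneg, hsum, hdiag, fun i j => ⟨k, hk, hprim i j⟩, k, hk, hprim⟩
end

section
/- Let Q ∈ ℝ^{m×m} be a primitive column-stochastic matrix, and let a, b : ℕ → ℝ^m evolve as a(k+1) = Q a(k) and b(k+1) = Q b(k), where b(0) has 𝟏_mᵀ b(0) > 0. Then for every index j, b_j(k) is nonzero for all sufficiently large k, and the ratio a_j(k)/b_j(k) converges as k → ∞ to (𝟏_mᵀ a(0)) / (𝟏_mᵀ b(0)). -/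
namespace Matrix

variable {n : Type*} [Fintype n]

/-- A matrix with unit column sums and entries at least `δ` contracts the `ℓ¹` norm of
zero-sum vectors by the factor `1 - card n * δ`. -/
theorem sum_abs_mulVec_le_of_sum_eq_zero {P : Matrix n n ℝ} {δ : ℝ} (hδ : ∀ i j, δ ≤ P i j)
    (hcol : ∀ j, ∑ i, P i j = 1) {x : n → ℝ} (hx : ∑ i, x i = 0) :
    ∑ i, |(P *ᵥ x) i| ≤ (1 - Fintype.card n * δ) * ∑ i, |x i| := by
  have hshift (i : n) : (P *ᵥ x) i = ∑ j, (P i j - δ) * x j := by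
    simp [sub_mul, Finset.sum_sub_distrib, ← Finset.mul_sum, hx, mulVec, dotProduct]
  calc ∑ i, |(P *ᵥ x) i| ≤ ∑ i, ∑ j, (P i j - δ) * |x j| := by
        refine Finset.sum_le_sum fun i _ => ?_
        rw [hshift]
        refine (Finset.abs_sum_le_sum_abs _ _).trans (Finset.sum_le_sum fun j _ => ?_)
        rw [abs_mul, abs_of_nonneg (sub_nonneg.2 (hδ i j))]
    _ = (1 - Fintype.card n * δ) * ∑ i, |x i| := by
        rw [Finset.sum_comm, Finset.mul_sum]
        refine Finset.sum_congr rfl fun j _ => ?_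
        rw [← Finset.sum_mul, Finset.sum_sub_distrib, hcol]
        simp

theorem exists_pos_forall_le_of_forall_pos {P : Matrix n n ℝ} (hP : ∀ i j, 0 < P i j) :
    ∃ δ > 0, ∀ i j, δ ≤ P i j := by
  obtain ⟨δ, hδ, h⟩ := Pi.exists_forall_pos_add_lt (x := fun _ : n × n => (0 : ℝ))
    (y := fun p => P p.1 p.2) fun p => hP p.1 p.2
  exact ⟨δ, hδ, fun i j => by simpa using (h (i, j)).le⟩

variable [DecidableEq n]

theorem IsPrimitive.tendsto_pow_mulVec_zero {Q : Matrix n n ℝ} (hQ : Q.IsPrimitive)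
    (hst : Q ∈ colStochastic ℝ n) {x : n → ℝ} (hx : ∑ i, x i = 0) (j : n) :
    Filter.Tendsto (fun k => (Q ^ k *ᵥ x) j) Filter.atTop (nhds 0) := by
  obtain ⟨N, -, hN⟩ := hQ.exists_pos_pow
  obtain ⟨δ, hδ, hle⟩ := exists_pos_forall_le_of_forall_pos hN
  have hsum (k : ℕ) : ∑ i, (Q ^ k *ᵥ x) i = 0 := by
    rw [sum_mulVec_of_mem_colStochastic (pow_mem hst k), hx]
  set f : ℕ → ℝ := fun k => ∑ i, |(Q ^ k *ᵥ x) i| with hf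
  have hf0 (k : ℕ) : 0 ≤ f k := Finset.sum_nonneg fun _ _ => abs_nonneg _
  have hanti : Antitone f := antitone_nat_of_succ_le fun k => by
    simpa [hf, pow_succ', mulVec_mulVec] using sum_abs_mulVec_le_of_sum_eq_zero
      (P := Q) (fun _ _ => nonneg_of_mem_colStochastic hst) (sum_col_of_mem_colStochastic hst)
      (hsum k)
  have hcontr (k : ℕ) : f (k + N) ≤ (1 - Fintype.card n * δ) * f k := by
    simpa [hf, add_comm k N, pow_add, mulVec_mulVec] using sum_abs_mulVec_le_of_sum_eq_zero
      hle (sum_col_of_mem_colStochastic (pow_mem hst N)) (hsum k)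
  have hlim := tendsto_atTop_ciInf hanti ⟨0, Set.forall_mem_range.2 hf0⟩
  have hL : (⨅ k, f k) = 0 := by
    have hL0 : 0 ≤ ⨅ k, f k := le_ciInf hf0
    have hLle := le_of_tendsto_of_tendsto' ((Filter.tendsto_add_atTop_iff_nat N).2 hlim)
      (hlim.const_mul _) hcontr
    have hcard : (0 : ℝ) < Fintype.card n := by
      exact_mod_cast Fintype.card_pos_iff.2 ⟨j⟩
    nlinarith [mul_pos hcard hδ]
  rw [hL] at hlim
  exact squeeze_zero_norm (fun k => Finset.single_le_sum (f := fun i => |(Q ^ k *ᵥ x) i|)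
    (fun _ _ => abs_nonneg _) (Finset.mem_univ j)) hlim

theorem IsPrimitive.exists_pos_eventually_le_pow_mulVec {Q : Matrix n n ℝ} (hQ : Q.IsPrimitive)
    (hst : Q ∈ colStochastic ℝ n) {x : n → ℝ} (hx : 0 < ∑ i, x i) (j : n) :
    ∃ ε > 0, ∀ᶠ k in Filter.atTop, ε ≤ (Q ^ k *ᵥ x) j := by
  obtain ⟨N, -, hN⟩ := hQ.exists_pos_pow
  obtain ⟨δ, hδ, hle⟩ := exists_pos_forall_le_of_forall_pos hN
  set s := ∑ i, x i
  set u : n → ℝ := Pi.single j s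
  have hu : ∑ i, u i = s := by simp [u]
  have hu0 (i : n) : 0 ≤ u i := (Pi.single_nonneg.2 hx.le : (0 : n → ℝ) ≤ u) i
  have hlow (k : ℕ) : δ * s ≤ (Q ^ (k + N) *ᵥ u) j := by
    rw [add_comm, pow_add, ← mulVec_mulVec, ← hu,
      ← sum_mulVec_of_mem_colStochastic (pow_mem hst k), Finset.mul_sum]
    exact Finset.sum_le_sum fun i _ => mul_le_mul_of_nonneg_right (hle j i)
      (nonneg_mulVec_of_mem_colStochastic (pow_mem hst k) hu0 i)
  have hdiff := hQ.tendsto_pow_mulVec_zero hst (x := x - u)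
    (by simp [Finset.sum_sub_distrib, hu, s]) j
  have hpos : 0 < δ * s := mul_pos hδ hx
  refine ⟨δ * s / 2, half_pos hpos, ?_⟩
  filter_upwards [hdiff.eventually_const_lt (show -(δ * s / 2) < 0 by linarith),
    Filter.eventually_ge_atTop N] with k hk hkN
  have hlow' := hlow (k - N)
  rw [Nat.sub_add_cancel hkN] at hlow'
  rw [mulVec_sub, Pi.sub_apply] at hk
  linarith

end Matrix

/-- **Ratio consensus for primitive column-stochastic matrices**
(the argument underlying Theorem 1, statement 1).
If `a (k+1) = Q (a k)`, `b (k+1) = Q (b k)` with `𝟙ᵀ b 0 > 0` and `Q` primitive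
column-stochastic, then each `b k j` is eventually nonzero and
`a k j / b k j → (𝟙ᵀ a 0)/(𝟙ᵀ b 0)`. -/
theorem primitive_push_sum_ratio
    (m : ℕ)
    (Q : Matrix (Fin m) (Fin m) ℝ)
    (hnonneg : ∀ i j, 0 ≤ Q i j)
    (hcol : ∀ j, ∑ i, Q i j = 1)
    (hprim : ∃ k : ℕ, 1 ≤ k ∧ ∀ i j, 0 < (Q ^ k) i j)
    (a b : ℕ → Fin m → ℝ)
    (ha : ∀ k, a (k + 1) = Q.mulVec (a k))
    (hb : ∀ k, b (k + 1) = Q.mulVec (b k))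
    (hb0 : 0 < ∑ i, b 0 i) :
    ∀ j : Fin m,
      (∀ᶠ k in Filter.atTop, b k j ≠ 0) ∧
      Filter.Tendsto (fun k => a k j / b k j) Filter.atTop
        (nhds ((∑ i, a 0 i) / (∑ i, b 0 i))) := by
  obtain ⟨N, hN1, hN⟩ := hprim
  have hQ : Q.IsPrimitive := ⟨hnonneg, N, hN1, hN⟩
  have hst : Q ∈ Matrix.colStochastic ℝ (Fin m) :=
    Matrix.mem_colStochastic_iff_sum.2 ⟨hnonneg, hcol⟩
  have horbit {v : ℕ → Fin m → ℝ} (hv : ∀ k, v (k + 1) = Q.mulVec (v k)) (k : ℕ) :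
      v k = (Q ^ k).mulVec (v 0) := by
    induction k with
    | zero => simp
    | succ k ih => rw [hv, ih, Matrix.mulVec_mulVec, pow_succ']
  intro j
  obtain ⟨ε, hε, hlow⟩ := hQ.exists_pos_eventually_le_pow_mulVec hst hb0 j
  simp_rw [← horbit hb] at hlow
  have hne : ∀ᶠ k in Filter.atTop, b k j ≠ 0 := hlow.mono fun k hk => (hε.trans_le hk).ne'
  refine ⟨hne, ?_⟩
  set c := (∑ i, a 0 i) / ∑ i, b 0 i with hc
  have hzero := hQ.tendsto_pow_mulVec_zero hst (x := a 0 - c • b 0)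
    (by simp [Finset.sum_sub_distrib, ← Finset.mul_sum, hc, hb0.ne']) j
  simp only [Matrix.mulVec_sub, Matrix.mulVec_smul, ← horbit ha, ← horbit hb, Pi.sub_apply,
    Pi.smul_apply, smul_eq_mul] at hzero
  rw [tendsto_iff_norm_sub_tendsto_zero]
  have hbound := hzero.norm.div_const ε
  rw [norm_zero, zero_div] at hbound
  refine squeeze_zero' (Filter.Eventually.of_forall fun _ => norm_nonneg _) ?_ hbound
  filter_upwards [hlow, hne] with k hk hk0
  rw [div_sub' hk0, norm_div, mul_comm (b k j)]
  exact div_le_div_of_nonneg_left (norm_nonneg _) hε (hk.trans (le_abs_self _))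
end

section
/- Let G be a strongly connected directed graph on n nodes with out-degrees d_j^+, and let P̂ ∈ ℝ^{2n×2n} be the block matrix P̂ = [[P, (1/2)I_n],[Λ, (1/2)I_n]], where P_{ij} = 1/(2+d_j^+) if (i,j) is an edge of G or i = j and P_{ij} = 0 otherwise, and Λ = diag(1/(2+d_1^+),…,1/(2+d_n^+)). For l ∈ {1,2}, let 2n-dimensional state vectors evolve as follows: the initial substates satisfy x_{i,1}^α(0) + x_{i,1}^β(0) = 2 x_i(0), x_{i,2}^α(0) = 0, x_{i,2}^β(0) = 2 for each node i; at k = 0 the update is x_{i,l}^α(1) = ∑_j p_{ij}(0) x_{j,l}^α(0) + x_{i,l}^β(0) and x_{i,l}^β(1) = a_i^{β,α}(0) x_{i,l}^α(0), where the real weights satisfy p_{ij}(0) = 0 whenever (i,j) is not an edge and i ≠ j, and ∑_{i=1}^n p_{ij}(0) + a_j^{β,α}(0) = 1 for every j; and for k ≥ 1 the stacked vector (x_{1,l}^α(k),…,x_{n,l}^α(k), x_{1,l}^β(k),…,x_{n,l}^β(k)) is multiplied by P̂. Then for every node j, x_{j,2}^α(k) is nonzero for all sufficiently large k and lim_{k→∞}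 x_{j,1}^α(k)/x_{j,2}^α(k) = (1/n) ∑_{i=1}^n x_i(0). -/
open Matrix in
/-- A matrix with unit column sums whose entries are all at least `δ` contracts the `ℓ¹` norm on
vectors of zero sum by the factor `1 - card ι * δ`. -/
lemma sum_abs_mulVec_le_of_le_entries {ι : Type*} [Fintype ι] {M : Matrix ι ι ℝ} {δ : ℝ}
    (hM : ∀ i j, δ ≤ M i j) (hcol : ∀ j, ∑ i, M i j = 1) {z : ι → ℝ} (hz : ∑ i, z i = 0) :
    ∑ i, |(M *ᵥ z) i| ≤ (1 - Fintype.card ι * δ) * ∑ i, |z i| := by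
  have key : ∀ i, |(M *ᵥ z) i| ≤ ∑ j, (M i j - δ) * |z j| := by
    intro i
    have h : (M *ᵥ z) i = ∑ j, (M i j - δ) * z j := by
      simp [Matrix.mulVec, dotProduct, sub_mul, Finset.sum_sub_distrib, ← Finset.mul_sum, hz]
    rw [h]
    refine (Finset.abs_sum_le_sum_abs _ _).trans (Finset.sum_le_sum fun j _ => ?_)
    rw [abs_mul, abs_of_nonneg (sub_nonneg.2 (hM i j))]
  refine (Finset.sum_le_sum fun i _ => key i).trans_eq ?_
  rw [Finset.sum_comm, Finset.mul_sum]
  refine Finset.sum_congr rfl fun j _ => ?_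
  rw [← Finset.sum_mul, Finset.sum_sub_distrib, hcol]
  simp

open Matrix in
/-- A matrix with unit column sums preserves the sum of the coordinates. -/
lemma sum_mulVec_of_colSum_eq_one {ι : Type*} [Fintype ι] {M : Matrix ι ι ℝ}
    (hcol : ∀ j, ∑ i, M i j = 1) (z : ι → ℝ) : ∑ i, (M *ᵥ z) i = ∑ i, z i := by
  simp only [Matrix.mulVec, dotProduct]
  rw [Finset.sum_comm]
  simp [← Finset.sum_mul, hcol]

/-- Unit column sums pass to powers. -/
lemma colSum_pow_eq_one {ι : Type*} [Fintype ι] [DecidableEq ι] {M : Matrix ι ι ℝ}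
    (hcol : ∀ j, ∑ i, M i j = 1) (k : ℕ) (j : ι) : ∑ i, (M ^ k) i j = 1 := by
  induction k generalizing j with
  | zero => simp [Matrix.one_apply]
  | succ k ih =>
    simp only [pow_succ, Matrix.mul_apply]
    rw [Finset.sum_comm]
    simp [← Finset.sum_mul, ih, hcol]

/-- Nonnegativity of the entries passes to powers. -/
lemma pow_entry_nonneg {ι : Type*} [Fintype ι] [DecidableEq ι] {M : Matrix ι ι ℝ}
    (hM : ∀ i j, 0 ≤ M i j) (k : ℕ) (i j : ι) : 0 ≤ (M ^ k) i j := by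
  induction k generalizing i j with
  | zero => rw [pow_zero, Matrix.one_apply]; split_ifs <;> norm_num
  | succ k ih =>
    rw [pow_succ, Matrix.mul_apply]
    exact Finset.sum_nonneg fun l _ => mul_nonneg (ih i l) (hM l j)

lemma pow_succ_entry_pos {ι : Type*} [Fintype ι] [DecidableEq ι] {M : Matrix ι ι ℝ}
    (hM : ∀ i j, 0 ≤ M i j) {k : ℕ} {i l j : ι} (h : 0 < (M ^ k) i l) (h' : 0 < M l j) :
    0 < (M ^ (k + 1)) i j := by
  rw [pow_succ, Matrix.mul_apply]
  exact Finset.sum_pos' (fun l _ => mul_nonneg (pow_entry_nonneg hM k i l) (hM l j))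
    ⟨l, Finset.mem_univ _, mul_pos h h'⟩

/-- An irreducible nonnegative matrix with positive diagonal is primitive. -/
lemma exists_pow_pos_of_reflTransGen {ι : Type*} [Fintype ι] [DecidableEq ι] {M : Matrix ι ι ℝ}
    (hM : ∀ i j, 0 ≤ M i j) (hdiag : ∀ i, 0 < M i i)
    (hirr : ∀ i j, Relation.ReflTransGen (fun a b => 0 < M a b) i j) :
    ∃ N, 0 < N ∧ ∀ i j, 0 < (M ^ N) i j := by
  have hex : ∀ i j, ∃ k, 0 < (M ^ k) i j := by
    intro i j
    induction hirr i j with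
    | refl => exact ⟨0, by simp⟩
    | tail _ h ih =>
      obtain ⟨k, hk⟩ := ih
      exact ⟨k + 1, pow_succ_entry_pos hM hk h⟩
  choose k hk using hex
  have hmono : ∀ i j m m', m ≤ m' → 0 < (M ^ m) i j → 0 < (M ^ m') i j := by
    intro i j m m' hmm h
    induction hmm with
    | refl => exact h
    | step _ ih => exact pow_succ_entry_pos hM ih (hdiag j)
  refine ⟨(∑ i, ∑ j, k i j) + 1, Nat.succ_pos _, fun i j => hmono i j (k i j) _ ?_ (hk i j)⟩
  calc k i j ≤ ∑ j, k i j := Finset.single_le_sum (fun _ _ => Nat.zero_le _) (Finset.mem_univ j)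
    _ ≤ ∑ i, ∑ j, k i j :=
      Finset.single_le_sum (f := fun i => ∑ j, k i j) (fun _ _ => Nat.zero_le _)
        (Finset.mem_univ i)
    _ ≤ _ := Nat.le_succ _

/-- A positive matrix on a finite index set has entries bounded below by a positive constant. -/
lemma exists_pos_le_entries {ι : Type*} [Fintype ι] {M : Matrix ι ι ℝ}
    (hM : ∀ i j, 0 < M i j) : ∃ δ, 0 < δ ∧ ∀ i j, δ ≤ M i j := by
  obtain h | h := isEmpty_or_nonempty ι
  · exact ⟨1, one_pos, fun i => h.elim i⟩
  · obtain ⟨p, hp⟩ := Finite.exists_min fun p : ι × ι => M p.1 p.2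
    exact ⟨M p.1 p.2, hM _ _, fun i j => hp (i, j)⟩

open Matrix in
/-- Powers of a column-stochastic primitive matrix send vectors of zero sum to zero. -/
lemma tendsto_pow_mulVec_zero {ι : Type*} [Fintype ι] [DecidableEq ι] [Nonempty ι]
    {M : Matrix ι ι ℝ} (hM : ∀ i j, 0 ≤ M i j) (hcol : ∀ j, ∑ i, M i j = 1)
    {N : ℕ} (hN : 0 < N) (hpos : ∀ i j, 0 < (M ^ N) i j) {z : ι → ℝ} (hz : ∑ i, z i = 0) (i : ι) :
    Filter.Tendsto (fun k => (M ^ k *ᵥ z) i) Filter.atTop (nhds 0) := by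
  obtain ⟨δ, hδ, hle⟩ := exists_pos_le_entries hpos
  have hsum : ∀ k, ∑ i, (M ^ k *ᵥ z) i = 0 := fun k => by
    rw [sum_mulVec_of_colSum_eq_one (colSum_pow_eq_one hcol k), hz]
  set f : ℕ → ℝ := fun k => ∑ i, |(M ^ k *ᵥ z) i| with hf
  have hanti : Antitone f := antitone_nat_of_succ_le fun k => by
    have := sum_abs_mulVec_le_of_le_entries hM hcol (hsum k)
    simpa [hf, pow_succ', Matrix.mulVec_mulVec] using this
  set r : ℝ := 1 - Fintype.card ι * δ with hr
  have hr1 : r < 1 := by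
    have : (0 : ℝ) < Fintype.card ι := by exact_mod_cast Fintype.card_pos
    have := mul_pos this hδ
    linarith
  have hr0 : 0 ≤ r := by
    have h := Finset.sum_le_sum fun i (_ : i ∈ Finset.univ) => hle i (Classical.arbitrary ι)
    rw [colSum_pow_eq_one hcol] at h
    simp at h
    linarith
  have hgeo : ∀ k, f (N * k) ≤ r ^ k * f 0 := by
    intro k
    induction k with
    | zero => simp
    | succ k ih =>
      have := sum_abs_mulVec_le_of_le_entries hle (colSum_pow_eq_one hcol N) (hsum (N * k))
      rw [Matrix.mulVec_mulVec, ← pow_add] at this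
      calc f (N * (k + 1)) ≤ r * f (N * k) := by
            simpa [hf, mul_add, add_comm] using this
        _ ≤ r * (r ^ k * f 0) := by gcongr
        _ = r ^ (k + 1) * f 0 := by ring
  have hsub : Filter.Tendsto (fun k => f (N * k)) Filter.atTop (nhds 0) := by
    refine squeeze_zero (fun k => Finset.sum_nonneg fun _ _ => abs_nonneg _) hgeo ?_
    simpa using (tendsto_pow_atTop_nhds_zero_of_lt_one hr0 hr1).mul_const (f 0)
  have hlim : Filter.Tendsto f Filter.atTop (nhds 0) :=
    (tendsto_iff_tendsto_subseq_of_antitone hanti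
      (Filter.tendsto_id.const_mul_atTop' hN)).2 hsub
  refine squeeze_zero_norm (fun k => ?_) hlim
  exact Finset.single_le_sum (f := fun i => |(M ^ k *ᵥ z) i|) (fun _ _ => abs_nonneg _)
    (Finset.mem_univ i)

open Matrix in
/-- Ratio consensus: for a column-stochastic primitive matrix, the coordinatewise ratios of two
orbits converge to the ratio of the coordinate sums, if the second orbit starts at a nonnegative
nonzero vector. -/
lemma ratio_consensus {ι : Type*} [Fintype ι] [DecidableEq ι] [Nonempty ι]
    {M : Matrix ι ι ℝ} (hM : ∀ i j, 0 ≤ M i j) (hcol : ∀ j, ∑ i, M i j = 1)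
    {N : ℕ} (hN : 0 < N) (hpos : ∀ i j, 0 < (M ^ N) i j) {x y : ι → ℝ}
    (hy : ∀ i, 0 ≤ y i) (hy0 : 0 < ∑ i, y i) (i : ι) :
    (∀ᶠ k in Filter.atTop, (M ^ k *ᵥ y) i ≠ 0) ∧
      Filter.Tendsto (fun k => (M ^ k *ᵥ x) i / (M ^ k *ᵥ y) i) Filter.atTop
        (nhds ((∑ i, x i) / ∑ i, y i)) := by
  obtain ⟨δ, hδ, hle⟩ := exists_pos_le_entries hpos
  set c := (∑ i, x i) / ∑ i, y i with hc
  have hlow : ∀ k, N ≤ k → δ * ∑ i, y i ≤ (M ^ k *ᵥ y) i := by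
    intro k hk
    obtain ⟨m, rfl⟩ := Nat.exists_eq_add_of_le hk
    rw [pow_add, ← Matrix.mulVec_mulVec, ← sum_mulVec_of_colSum_eq_one (colSum_pow_eq_one hcol m) y,
      Finset.mul_sum]
    refine Finset.sum_le_sum fun j _ => mul_le_mul_of_nonneg_right (hle i j) ?_
    exact Finset.sum_nonneg fun l _ => mul_nonneg (pow_entry_nonneg hM m j l) (hy l)
  have hδy : 0 < δ * ∑ i, y i := mul_pos hδ hy0
  have hne : ∀ᶠ k in Filter.atTop, (M ^ k *ᵥ y) i ≠ 0 :=
    (Filter.eventually_ge_atTop N).mono fun k hk => (hδy.trans_le (hlow k hk)).ne'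
  refine ⟨hne, ?_⟩
  have hz : ∑ i, (x - c • y) i = 0 := by
    simp only [Pi.sub_apply, Pi.smul_apply, smul_eq_mul, Finset.sum_sub_distrib, ← Finset.mul_sum]
    rw [hc, div_mul_cancel₀ _ hy0.ne', sub_self]
  have hlim := tendsto_pow_mulVec_zero hM hcol hN hpos hz i
  have hdiff : Filter.Tendsto (fun k => (M ^ k *ᵥ x) i / (M ^ k *ᵥ y) i - c) Filter.atTop
      (nhds 0) := by
    have hbd : Filter.Tendsto (fun k => |(M ^ k *ᵥ (x - c • y)) i| / (δ * ∑ i, y i)) Filter.atTop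
        (nhds 0) := by
      simpa using hlim.abs.div_const (δ * ∑ i, y i)
    refine squeeze_zero_norm' ?_ hbd
    filter_upwards [Filter.eventually_ge_atTop N, hne] with k hk hk0
    have heq : (M ^ k *ᵥ x) i / (M ^ k *ᵥ y) i - c
        = (M ^ k *ᵥ (x - c • y)) i / (M ^ k *ᵥ y) i := by
      rw [Matrix.mulVec_sub, Matrix.mulVec_smul]
      simp only [Pi.sub_apply, Pi.smul_apply, smul_eq_mul]
      field_simp
    rw [heq, Real.norm_eq_abs, abs_div]
    exact div_le_div_of_nonneg_left (abs_nonneg _) hδy ((hlow k hk).trans (le_abs_self _))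
  simpa using hdiff.add_const c


/-- **Theorem 1, statement 1 (correctness of PrFTPS).**
The state-decomposition-based push-sum iteration (2), under the weight mechanism
(arbitrary column-sum-one weights at `k = 0`, the fixed column-stochastic matrix
`P̂ = [[P, (1/2)I],[Λ, (1/2)I]]` for `k ≥ 1`), computes the exact average of the
private initial values: for every node `j`, `x_{j,2}^α(k)` is eventually nonzero
and `x_{j,1}^α(k)/x_{j,2}^α(k) → (1/n) ∑ᵢ xᵢ(0)`. -/
theorem prftps_exact_average
    (n : ℕ) (hn : 0 < n)
    (E : Fin n → Fin n → Prop) [DecidableRel E]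
    (hconn : ∀ i j : Fin n, i ≠ j → Relation.TransGen E i j)
    (d : Fin n → ℕ)
    (hd : ∀ j, d j = Nat.card {i : Fin n // i ≠ j ∧ E i j})
    (P : Matrix (Fin n) (Fin n) ℝ)
    (hP : ∀ i j, P i j = if E i j ∨ i = j then ((2 : ℝ) + d j)⁻¹ else 0)
    (Phat : Matrix (Fin n ⊕ Fin n) (Fin n ⊕ Fin n) ℝ)
    (hPhat : Phat = Matrix.fromBlocks P ((2 : ℝ)⁻¹ • (1 : Matrix (Fin n) (Fin n) ℝ))
        (Matrix.diagonal fun j => ((2 : ℝ) + d j)⁻¹)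
        ((2 : ℝ)⁻¹ • (1 : Matrix (Fin n) (Fin n) ℝ)))
    (x0 : Fin n → ℝ)
    -- substates: `xa k`, `xb k` are `x^α_{·,1}(k)`, `x^β_{·,1}(k)`;
    -- `ya k`, `yb k` are `x^α_{·,2}(k)`, `x^β_{·,2}(k)`
    (xa xb ya yb : ℕ → Fin n → ℝ)
    (hinit1 : ∀ i, xa 0 i + xb 0 i = 2 * x0 i)
    (hinit2a : ∀ i, ya 0 i = 0)
    (hinit2b : ∀ i, yb 0 i = 2)
    -- the `k = 0` weights and update
    (p0 : Fin n → Fin n → ℝ) (a0 : Fin n → ℝ)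
    (hp0 : ∀ i j, ¬ E i j → i ≠ j → p0 i j = 0)
    (hcol0 : ∀ j, (∑ i, p0 i j) + a0 j = 1)
    (hstep0a : ∀ i, xa 1 i = (∑ j, p0 i j * xa 0 j) + xb 0 i)
    (hstep0b : ∀ i, xb 1 i = a0 i * xa 0 i)
    (hstep0c : ∀ i, ya 1 i = (∑ j, p0 i j * ya 0 j) + yb 0 i)
    (hstep0d : ∀ i, yb 1 i = a0 i * ya 0 i)
    -- for `k ≥ 1` the stacked vectors are multiplied by `P̂`
    (hstep : ∀ k : ℕ, 1 ≤ k →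
      Sum.elim (xa (k + 1)) (xb (k + 1)) = Phat.mulVec (Sum.elim (xa k) (xb k)) ∧
      Sum.elim (ya (k + 1)) (yb (k + 1)) = Phat.mulVec (Sum.elim (ya k) (yb k))) :
    ∀ j : Fin n,
      (∀ᶠ k in Filter.atTop, ya k j ≠ 0) ∧
      Filter.Tendsto (fun k => xa k j / ya k j) Filter.atTop
        (nhds ((∑ i, x0 i) / n)) := by
  have hdpos : ∀ j, (0 : ℝ) < ((2 : ℝ) + d j)⁻¹ := fun j => by positivity
  have hcolP : ∀ j, ∑ i, P i j + ((2 : ℝ) + d j)⁻¹ = 1 := by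
    intro j
    have hcard : ((Finset.univ.filter fun i => E i j ∨ i = j).card : ℝ) = d j + 1 := by
      have hset : (Finset.univ.filter fun i => E i j ∨ i = j)
          = insert j (Finset.univ.filter fun i => i ≠ j ∧ E i j) := by
        ext i
        simp only [Finset.mem_filter, Finset.mem_univ, true_and, Finset.mem_insert]
        tauto
      rw [hset, Finset.card_insert_of_notMem (by simp), hd j, Nat.card_eq_fintype_card,
        Fintype.card_subtype]
      push_cast
      rfl
    simp only [hP]
    rw [← Finset.sum_filter, Finset.sum_const, nsmul_eq_mul, hcard]
    have : (2 : ℝ) + d j ≠ 0 := by positivity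
    field_simp
    ring
  have hcol : ∀ j, ∑ i, Phat i j = 1 := by
    rintro (j | j)
    · simpa [hPhat, Fintype.sum_sum_type, Matrix.diagonal_apply] using hcolP j
    · simp [hPhat, Fintype.sum_sum_type, Matrix.one_apply]
      norm_num
  have hnonneg : ∀ i j, 0 ≤ Phat i j := by
    rintro (i | i) (j | j)
    · simp only [hPhat, Matrix.fromBlocks_apply₁₁, hP]
      split_ifs
      exacts [(hdpos j).le, le_rfl]
    · simp only [hPhat, Matrix.fromBlocks_apply₁₂, Matrix.smul_apply, Matrix.one_apply]
      split_ifs <;> norm_num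
    · simp only [hPhat, Matrix.fromBlocks_apply₂₁, Matrix.diagonal_apply]
      split_ifs
      exacts [(hdpos i).le, le_rfl]
    · simp only [hPhat, Matrix.fromBlocks_apply₂₂, Matrix.smul_apply, Matrix.one_apply]
      split_ifs <;> norm_num
  have hEdge : ∀ i j, E i j ∨ i = j → 0 < Phat (Sum.inl i) (Sum.inl j) := by
    intro i j h
    simpa [hPhat, hP, h] using hdpos j
  have hab : ∀ i, 0 < Phat (Sum.inl i) (Sum.inr i) := fun i => by simp [hPhat]
  have hba : ∀ i, 0 < Phat (Sum.inr i) (Sum.inl i) := fun i => by simpa [hPhat] using hdpos i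
  have hdiag : ∀ i, 0 < Phat i i := by
    rintro (i | i)
    · exact hEdge i i (Or.inr rfl)
    · simp [hPhat]
  have hll : ∀ i j, Relation.ReflTransGen (fun a b => 0 < Phat a b) (Sum.inl i) (Sum.inl j) := by
    intro i j
    by_cases h : i = j
    · rw [h]
    · exact ((hconn i j h).lift Sum.inl fun a b hE => hEdge a b (Or.inl hE)).to_reflTransGen
  have hirr : ∀ i j, Relation.ReflTransGen (fun a b => 0 < Phat a b) i j := by
    rintro (i | i) (j | j)
    · exact hll i j
    · exact (hll i j).tail (hab j)
    · exact (hll i j).head (hba i)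
    · exact ((hll i j).tail (hab j)).head (hba i)
  obtain ⟨N, hN, hpos⟩ := exists_pow_pos_of_reflTransGen hnonneg hdiag hirr
  have horbit : ∀ k, Sum.elim (xa (k + 1)) (xb (k + 1)) = (Phat ^ k).mulVec (Sum.elim (xa 1) (xb 1))
      ∧ Sum.elim (ya (k + 1)) (yb (k + 1)) = (Phat ^ k).mulVec (Sum.elim (ya 1) (yb 1)) := by
    intro k
    induction k with
    | zero => simp
    | succ k ih =>
      obtain ⟨h₁, h₂⟩ := hstep (k + 1) (Nat.succ_pos k)
      rw [h₁, h₂, ih.1, ih.2, Matrix.mulVec_mulVec, Matrix.mulVec_mulVec, ← pow_succ']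
      exact ⟨rfl, rfl⟩
  have hya : ∀ i, ya 1 i = 2 := fun i => by simp [hstep0c, hinit2a, hinit2b]
  have hyb : ∀ i, yb 1 i = 0 := fun i => by simp [hstep0d, hinit2a]
  have hsumx : ∑ i, Sum.elim (xa 1) (xb 1) i = 2 * ∑ i, x0 i := by
    have hswap : ∑ i, ∑ j, p0 i j * xa 0 j = ∑ j, (∑ i, p0 i j) * xa 0 j := by
      rw [Finset.sum_comm]
      simp [Finset.sum_mul]
    simp only [Fintype.sum_sum_type, Sum.elim_inl, Sum.elim_inr, hstep0a, hstep0b,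
      Finset.sum_add_distrib, hswap, Finset.mul_sum, ← hinit1]
    rw [add_right_comm, ← Finset.sum_add_distrib]
    simp [← add_mul, hcol0]
  have hsumy : ∑ i, Sum.elim (ya 1) (yb 1) i = 2 * n := by
    simp [Fintype.sum_sum_type, hya, hyb, mul_comm]
  have hn' : (0 : ℝ) < n := by exact_mod_cast hn
  intro j
  have : Nonempty (Fin n ⊕ Fin n) := ⟨Sum.inl j⟩
  obtain ⟨h₁, h₂⟩ := ratio_consensus hnonneg hcol hN hpos (x := Sum.elim (xa 1) (xb 1))
    (y := Sum.elim (ya 1) (yb 1)) (by rintro (i | i) <;> simp [hya, hyb])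
    (by rw [hsumy]; positivity) (Sum.inl j)
  simp only [← (horbit _).1, ← (horbit _).2, Sum.elim_inl] at h₁ h₂
  rw [hsumx, hsumy, mul_div_mul_left _ _ two_ne_zero] at h₂
  refine ⟨?_, (Filter.tendsto_add_atTop_iff_nat 1).1 h₂⟩
  obtain ⟨K, hK⟩ := Filter.eventually_atTop.1 h₁
  filter_upwards [Filter.eventually_ge_atTop (K + 1)] with k hk
  obtain ⟨m, rfl⟩ := Nat.exists_eq_add_of_le' (Nat.one_le_of_lt hk)
  exact hK m (by omega)
end

section
/- Consider n ≥ 2 nodes on a directed graph with edge set E, and the k = 0 step of the state-decomposition iteration: x_i^α(1) = ∑_{l=1}^n p_{il} x_l^α(0) + x_i^β(0) and x_i^β(1) = a_i x_i^α(0) for each node i, where p_{il} = 0 whenever (i,l) ∉ E and i ≠ l, and ∑_{i=1}^n p_{il} + a_l = 1 for every l. Let j ≠ m be nodes such that (j,m) ∈ E (i.e., m is an in-neighbor of j), suppose x_m^α(0) ≠ 0, and let e ∈ ℝ. Define modified data by: x_j^β(0)'' = x_j^β(0) + 2e, x_m^β(0)'' = x_m^β(0) − 2e, p_{mm}'' =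 p_{mm} + 2e/x_m^α(0), p_{jm}'' = p_{jm} − 2e/x_m^α(0), with all other initial substates and weights unchanged. Then: (i) the modified weights still satisfy the zero-pattern and column-sum constraints; (ii) the modified iteration yields x_i^α(1)'' = x_i^α(1) and x_i^β(1)'' = x_i^β(1) for every node i, so all states at every step k ≥ 1 coincide with those of the unmodified iteration (for any common dynamics used from k = 1 on); and (iii) the private initial values x_i(0) = (x_i^α(0) + x_i^β(0))/2 satisfy x_j(0)'' = x_j(0) + e, x_m(0)'' = x_m(0) − e, and x_q(0)'' = x_q(0) for all q ∉ {j, m}. -/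
/-- **Privacy indistinguishability, Situation I** (proof of Theorem 2, eqs. (8)–(9)).
Let `m` be an in-neighbor of `j` (`(j,m) ∈ E`) with `xα m ≠ 0`.  Shifting
`xβ j` by `+2e`, `xβ m` by `−2e`, `p m m` by `+2e/xα m` and `p j m` by `−2e/xα m`
(i) preserves the zero-pattern and column-sum constraints on the weights,
(ii) leaves all substates from step `1` onwards unchanged (hence all later states
under any common dynamics), and (iii) shifts the private values `x j (0)` by `+e`,
`x m (0)` by `−e`, leaving the rest unchanged. -/
theorem privacy_situation_I
    (n : ℕ) (hn : 2 ≤ n)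
    (E : Fin n → Fin n → Prop)
    (p : Fin n → Fin n → ℝ) (a : Fin n → ℝ)
    (hzero : ∀ i l, ¬ E i l → i ≠ l → p i l = 0)
    (hcol : ∀ l, (∑ i, p i l) + a l = 1)
    (xα xβ : Fin n → ℝ)
    (j m : Fin n) (hjm : j ≠ m) (hedge : E j m) (hxm : xα m ≠ 0) (e : ℝ)
    (xβ' : Fin n → ℝ)
    (hxβ' : xβ' = fun i =>
      if i = j then xβ j + 2 * e else if i = m then xβ m - 2 * e else xβ i)
    (p' : Fin n → Fin n → ℝ)
    (hp' : p' = fun i l =>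
      if i = m ∧ l = m then p m m + 2 * e / xα m
      else if i = j ∧ l = m then p j m - 2 * e / xα m
      else p i l) :
    -- (i) the modified weights satisfy the same constraints
    ((∀ i l, ¬ E i l → i ≠ l → p' i l = 0) ∧ (∀ l, (∑ i, p' i l) + a l = 1)) ∧
    -- (ii) the states at step 1 coincide, hence so do all later states
    ((∀ i, (∑ l, p' i l * xα l) + xβ' i = (∑ l, p i l * xα l) + xβ i) ∧
     (∀ i, a i * xα i = a i * xα i) ∧
     (∀ (step : ((Fin n → ℝ) × (Fin n → ℝ)) → ((Fin n → ℝ) × (Fin n → ℝ))) (k : ℕ),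
        step^[k] (fun i => (∑ l, p' i l * xα l) + xβ' i, fun i => a i * xα i)
          = step^[k] (fun i => (∑ l, p i l * xα l) + xβ i, fun i => a i * xα i))) ∧
    -- (iii) the private values are shifted by ±e
    (((xα j + xβ' j) / 2 = (xα j + xβ j) / 2 + e) ∧
     ((xα m + xβ' m) / 2 = (xα m + xβ m) / 2 - e) ∧
     (∀ q, q ≠ j → q ≠ m → (xα q + xβ' q) / 2 = (xα q + xβ q) / 2)) := by
  have hdiff : ∀ i l, p' i l = p i l + ((if l = m then if i = m then 2 * e / xα m else 0 else 0)
      - (if l = m then if i = j then 2 * e / xα m else 0 else 0)) := by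
    intro i l
    subst hp'
    by_cases hl : l = m <;> by_cases hi : i = m <;> by_cases hij : i = j <;> simp_all
    ring
  have hstate : ∀ i, (∑ l, p' i l * xα l) + xβ' i = (∑ l, p i l * xα l) + xβ i := by
    intro i
    simp only [hdiff, add_mul, sub_mul, ite_mul, zero_mul, Finset.sum_add_distrib,
      Finset.sum_sub_distrib, Finset.sum_ite_eq', Finset.mem_univ, if_true,
      div_mul_cancel₀ _ hxm]
    subst hxβ'
    by_cases hi : i = m
    · subst hi
      simp [hjm.symm]
    · by_cases hij : i = j
      · subst hij
        simp [hjm]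
        ring
      · simp [hi, hij]
  refine ⟨⟨fun i l hE hil => ?_, fun l => ?_⟩,
    ⟨hstate, fun _ => rfl, fun step k => by simp only [hstate]⟩, ?_, ?_, fun q hqj hqm => ?_⟩
  · have hm : ¬ (i = m ∧ l = m) := fun h => hil (h.1.trans h.2.symm)
    have hj : ¬ (i = j ∧ l = m) := fun h => hE (by rw [h.1, h.2]; exact hedge)
    simp only [hp', hm, hj, if_false]
    exact hzero i l hE hil
  · rw [← hcol l]
    by_cases hl : l = m <;> simp [hdiff, hl, Finset.sum_add_distrib]
  · simp only [hxβ', if_true]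
    ring
  · simp only [hxβ', hjm.symm, if_true, if_false]
    ring
  · simp only [hxβ', hqj, hqm, if_false]
end

section
/- Consider n ≥ 2 nodes on a directed graph with edge set E, and the k = 0 step of the state-decomposition iteration: x_i^α(1) = ∑_{l=1}^n p_{il} x_l^α(0) + x_i^β(0) and x_i^β(1) = a_i x_i^α(0) for each node i, where p_{il} = 0 whenever (i,l) ∉ E and i ≠ l, and ∑_{i=1}^n p_{il} + a_l = 1 for every l. Let j ≠ m be nodes such that (m,j) ∈ E (i.e., m is an out-neighbor of j), suppose x_j^α(0) ≠ 0, and let e ∈ ℝ. Define modified data by: x_j^β(0)'' = x_j^β(0) + 2e, x_m^β(0)'' = x_m^β(0) − 2e, p_{jj}'' = p_{jj} − 2e/x_j^α(0), p_{mj}'' = p_{mj} + 2e/x_j^α(0), with all other initial substates and weights unchanged. Then: (i) the modified weights still satisfy the zero-pattern and column-sum constraints; (ii) the modified iteration yields x_i^α(1)'' = x_i^α(1) and x_i^β(1)'' = x_i^β(1) for every node i, so all states at every step k ≥ 1 coincide with those of the unmodified iteration (for any common dynamics used from k = 1 on); and (iii) the private initial values x_i(0) = (x_i^α(0) + x_i^β(0))/2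 satisfy x_j(0)'' = x_j(0) + e, x_m(0)'' = x_m(0) − e, and x_q(0)'' = x_q(0) for all q ∉ {j, m}. -/
/-- **Privacy indistinguishability, Situation II** (proof of Theorem 2, eqs. (8) and (10)).
Let `m` be an out-neighbor of `j` (`(m,j) ∈ E`) with `xα j ≠ 0`.  Shifting
`xβ j` by `+2e`, `xβ m` by `−2e`, `p j j` by `−2e/xα j` and `p m j` by `+2e/xα j`
(i) preserves the zero-pattern and column-sum constraints on the weights,
(ii) leaves all substates from step `1` onwards unchanged (hence all later states
under any common dynamics), and (iii) shifts the private values `x j (0)` by `+e`,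
`x m (0)` by `−e`, leaving the rest unchanged. -/
theorem privacy_situation_II
    (n : ℕ) (hn : 2 ≤ n)
    (E : Fin n → Fin n → Prop)
    (p : Fin n → Fin n → ℝ) (a : Fin n → ℝ)
    (hzero : ∀ i l, ¬ E i l → i ≠ l → p i l = 0)
    (hcol : ∀ l, (∑ i, p i l) + a l = 1)
    (xα xβ : Fin n → ℝ)
    (j m : Fin n) (hjm : j ≠ m) (hedge : E m j) (hxj : xα j ≠ 0) (e : ℝ)
    (xβ' : Fin n → ℝ)
    (hxβ' : xβ' = fun i =>
      if i = j then xβ j + 2 * e else if i = m then xβ m - 2 * e else xβ i)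
    (p' : Fin n → Fin n → ℝ)
    (hp' : p' = fun i l =>
      if i = j ∧ l = j then p j j - 2 * e / xα j
      else if i = m ∧ l = j then p m j + 2 * e / xα j
      else p i l) :
    -- (i) the modified weights satisfy the same constraints
    ((∀ i l, ¬ E i l → i ≠ l → p' i l = 0) ∧ (∀ l, (∑ i, p' i l) + a l = 1)) ∧
    -- (ii) the states at step 1 coincide, hence so do all later states
    ((∀ i, (∑ l, p' i l * xα l) + xβ' i = (∑ l, p i l * xα l) + xβ i) ∧
     (∀ i, a i * xα i = a i * xα i) ∧
     (∀ (step : ((Fin n → ℝ) × (Fin n → ℝ)) → ((Fin n → ℝ) × (Fin n → ℝ))) (k : ℕ),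
        step^[k] (fun i => (∑ l, p' i l * xα l) + xβ' i, fun i => a i * xα i)
          = step^[k] (fun i => (∑ l, p i l * xα l) + xβ i, fun i => a i * xα i))) ∧
    -- (iii) the private values are shifted by ±e
    (((xα j + xβ' j) / 2 = (xα j + xβ j) / 2 + e) ∧
     ((xα m + xβ' m) / 2 = (xα m + xβ m) / 2 - e) ∧
     (∀ q, q ≠ j → q ≠ m → (xα q + xβ' q) / 2 = (xα q + xβ q) / 2)) := by
  have hp_add : ∀ i l, p' i l = p i l +
      if l = j then (if i = j then -(2 * e / xα j) else 0) +
        (if i = m then 2 * e / xα j else 0) else 0 := by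
    intro i l
    rw [hp']
    by_cases hl : l = j
    · by_cases hij : i = j
      · simp [hl, hij, hjm, sub_eq_add_neg]
      · by_cases him : i = m <;> simp [hl, him, hjm.symm, hij]
    · simp [hl]
  have hstep : ∀ i, (∑ l, p' i l * xα l) + xβ' i = (∑ l, p i l * xα l) + xβ i := by
    intro i
    simp only [hp_add, add_mul, Finset.sum_add_distrib, ite_mul, zero_mul,
      Finset.sum_ite_eq', Finset.mem_univ, if_true, hxβ']
    by_cases hij : i = j
    · subst hij
      simp only [if_true, if_neg hjm]
      field_simp
      ring
    · by_cases him : i = m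
      · subst him
        simp only [if_true, if_neg hij]
        field_simp
        ring
      · simp [hij, him]
  refine ⟨⟨?_, ?_⟩, ⟨hstep, fun _ => rfl, ?_⟩, ?_, ?_, ?_⟩
  · intro i l hE hil
    rw [hp_add, hzero i l hE hil]
    by_cases hl : l = j
    · subst hl
      have him : i ≠ m := fun h => hE (h ▸ hedge)
      simp [hil, him]
    · simp [hl]
  · intro l
    rw [← hcol l]
    by_cases hl : l = j <;> simp [hp_add, hl, Finset.sum_add_distrib]
  · intro step k
    simp only [hstep]
  · simp only [hxβ', if_true]
    ring
  · simp only [hxβ', if_true, if_neg hjm.symm]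
    ring
  · intro q hqj hqm
    simp [hxβ', hqj, hqm]
end
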